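/- Let θ' ∈ {0,1}^n and let C ⊂ {0,1}^n be such that every θ'' ∈ C has Hamming distance at least d/2 from a fixed string θ̄. Let |φ⟩ = Σ_{y ∈ B_δ(0^n)} α_y |ξ_y⟩_A ⊗ |y⟩_{θ̄} be a normalized bipartite state whose B-part is a superposition (in the rotated basis determined by θ̄) over strings y of Hamming weight at most δn. Then for every θ'' ∈ C, Tr((id_A ⊗ |0^n⟩⟨0^n|_{θ''}) |φ⟩⟨φ|) ≤ 2^{−d/2 + n·h(δ)}, where h is the binary entropy function. -/

import Mathlib

open scoped Kronecker ComplexOrder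
open Matrix

noncomputable section

/-- Single-qubit amplitude `⟨c|b⟩_θ`: basis `θ = false` is computational, `θ = true` is
Hadamard (diagonal). -/
def qubitAmp (θb yb cb : Bool) : ℂ :=
  if θb then ((if yb && cb then -1 else 1) : ℂ) / (Real.sqrt 2 : ℂ)
  else if cb = yb then 1 else 0

/-- The state `|y⟩_θ` encoded qubit-wise in the bases given by `θ`. -/
def ketTheta {n : ℕ} (θ y : Fin n → Bool) : (Fin n → Bool) → ℂ :=
  fun c => ∏ i, qubitAmp (θ i) (y i) (c i)

/-- The binary entropy function. -/
def binEnt (δ : ℝ) : ℝ := -δ * Real.logb 2 δ - (1 - δ) * Real.logb 2 (1 - δ)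

/-- The Hamming ball of radius `δn` around `0^n`. -/
def hammingBall0 (n : ℕ) (δ : ℝ) : Finset (Fin n → Bool) :=
  Finset.univ.filter fun y => ((hammingDist y (fun _ => false) : ℝ) ≤ δ * n)

/-- Inner products of product states factor over the qubits. -/
lemma star_ketTheta_dotProduct {n : ℕ} (θ θ' y y' : Fin n → Bool) :
    star (ketTheta θ y) ⬝ᵥ ketTheta θ' y' =
      ∏ i, ∑ b, star (qubitAmp (θ i) (y i) b) * qubitAmp (θ' i) (y' i) b := by
  rw [Finset.prod_univ_sum, Fintype.piFinset_univ]
  simp only [Pi.star_apply, star_prod, dotProduct, ketTheta, Finset.prod_mul_distrib]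

lemma ofReal_sqrt_two_sq : ((Real.sqrt 2 : ℝ) : ℂ) ^ 2 = 2 := by
  rw [← Complex.ofReal_pow, Real.sq_sqrt zero_le_two, Complex.ofReal_ofNat]

lemma qubitAmp_orthonormal (θ y y' : Bool) :
    ∑ b, star (qubitAmp θ y b) * qubitAmp θ y' b = if y = y' then 1 else 0 := by
  have h2 := ofReal_sqrt_two_sq
  have h0 : ((Real.sqrt 2 : ℝ) : ℂ) ≠ 0 := by simp
  cases θ <;> cases y <;> cases y' <;> simp [qubitAmp] <;> field_simp <;> rw [h2] <;> norm_num

lemma ketTheta_orthonormal {n : ℕ} (θ y y' : Fin n → Bool) :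
    star (ketTheta θ y) ⬝ᵥ ketTheta θ y' = if y = y' then 1 else 0 := by
  simp only [star_ketTheta_dotProduct, qubitAmp_orthonormal, Finset.prod_ite_zero, funext_iff]
  simp

lemma normSq_qubitAmp_overlap_le (θ θ' y y' : Bool) :
    Complex.normSq (∑ b, star (qubitAmp θ y b) * qubitAmp θ' y' b) ≤
      if θ ≠ θ' then 2⁻¹ else 1 := by
  by_cases h : θ = θ'
  · subst h
    rw [qubitAmp_orthonormal]
    split_ifs <;> simp_all
  · cases θ <;> cases θ' <;> cases y <;> cases y' <;> simp_all [qubitAmp]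

/-- Product states encoded in bases at Hamming distance `k` have squared overlap at most `2⁻ᵏ`. -/
lemma normSq_ketTheta_overlap_le {n : ℕ} (θ θ' y y' : Fin n → Bool) :
    Complex.normSq (star (ketTheta θ y) ⬝ᵥ ketTheta θ' y') ≤ 2⁻¹ ^ hammingDist θ θ' := by
  rw [star_ketTheta_dotProduct, map_prod]
  refine (Finset.prod_le_prod (fun i _ => Complex.normSq_nonneg _)
    fun i _ => normSq_qubitAmp_overlap_le _ _ _ _).trans_eq ?_
  rw [Finset.prod_ite]
  simp [hammingDist]

/-- The probabilities of all strings under independent Bernoulli bits add up to one. -/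
lemma sum_pow_hammingDist (n : ℕ) (δ : ℝ) :
    ∑ y : Fin n → Bool, δ ^ hammingDist y (fun _ => false) *
      (1 - δ) ^ (n - hammingDist y (fun _ => false)) = 1 := by
  have h : ∏ _i : Fin n, ∑ b : Bool, (if b ≠ false then δ else 1 - δ) = 1 := by simp
  rw [Finset.prod_univ_sum, Fintype.piFinset_univ] at h
  refine Eq.trans (Finset.sum_congr rfl fun y _ => ?_) h
  have hc := Finset.card_filter_add_card_filter_not (s := (Finset.univ : Finset (Fin n)))
    (fun i => y i ≠ false)
  rw [Finset.card_univ, Fintype.card_fin] at hc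
  rw [Finset.prod_ite, Finset.prod_const, Finset.prod_const, hammingDist]
  congr 2
  omega

lemma two_rpow_neg_binEnt_le {n k : ℕ} {δ : ℝ} (hδ0 : 0 ≤ δ) (hδ : δ ≤ 1 / 2) (hkn : k ≤ n)
    (hk : (k : ℝ) ≤ δ * n) :
    (2 : ℝ) ^ (-(n * binEnt δ)) ≤ δ ^ k * (1 - δ) ^ (n - k) := by
  rcases hδ0.eq_or_lt with rfl | hpos
  · have : k = 0 := by simpa using hk
    simp [this, binEnt]
  have h1 : 0 < 1 - δ := by linarith
  rw [← Real.le_logb_iff_rpow_le one_lt_two (by positivity),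
    Real.logb_mul (by positivity) (by positivity), Real.logb_pow, Real.logb_pow,
    Nat.cast_sub hkn, binEnt]
  have hlog : Real.logb 2 δ ≤ Real.logb 2 (1 - δ) :=
    Real.logb_le_logb_of_le one_lt_two hpos (by linarith)
  nlinarith [mul_nonneg (sub_nonneg.2 hk) (sub_nonneg.2 hlog)]

lemma card_hammingBall0_le (n : ℕ) {δ : ℝ} (hδ0 : 0 ≤ δ) (hδ : δ ≤ 1 / 2) :
    ((hammingBall0 n δ).card : ℝ) ≤ 2 ^ (n * binEnt δ) := by
  have h1 : 0 ≤ 1 - δ := by linarith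
  have h : ((hammingBall0 n δ).card : ℝ) * 2 ^ (-(n * binEnt δ)) ≤ 1 := by
    rw [← sum_pow_hammingDist n δ, ← nsmul_eq_mul]
    refine (Finset.card_nsmul_le_sum _ _ _ fun y hy => ?_).trans
      (Finset.sum_le_univ_sum_of_nonneg fun y => by positivity)
    refine two_rpow_neg_binEnt_le hδ0 hδ ?_ (Finset.mem_filter.1 hy).2
    simpa using hammingDist_le_card_fintype (x := y) (y := fun _ => false)
  rwa [Real.rpow_neg zero_le_two, ← div_eq_mul_inv, div_le_one (by positivity)] at h

/-- The expectation of `1 ⊗ |u⟩⟨u|` is the squared norm of the partial overlap with `u`. -/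
lemma star_dotProduct_one_kronecker_vecMulVec {ι κ : Type*} [Fintype ι] [DecidableEq ι]
    [Fintype κ] (u : κ → ℂ) (φ : ι × κ → ℂ) :
    star φ ⬝ᵥ (((1 : Matrix ι ι ℂ) ⊗ₖ vecMulVec u (star u)).mulVec φ) =
      ∑ a, (Complex.normSq (star u ⬝ᵥ fun c => φ (a, c)) : ℂ) := by
  have hmul (a : ι) (c : κ) : (((1 : Matrix ι ι ℂ) ⊗ₖ vecMulVec u (star u)).mulVec φ) (a, c) =
      u c * (star u ⬝ᵥ fun c => φ (a, c)) := by
    simp [mulVec, dotProduct, Fintype.sum_prod_type, Matrix.one_apply, vecMulVec_apply,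
      Finset.mul_sum, mul_assoc]
  rw [dotProduct, Fintype.sum_prod_type]
  refine Finset.sum_congr rfl fun a _ => ?_
  rw [Complex.normSq_eq_conj_mul_self]
  simp only [hmul, ← mul_assoc, ← Finset.sum_mul]
  congr 1
  simp [dotProduct, mul_comm]

/-- The squared norm of a superposition of product vectors whose second factors are
orthonormal. -/
lemma star_dotProduct_sum_orthonormal {ι κ Y : Type*} [Fintype ι] [Fintype κ] [DecidableEq Y]
    (s : Finset Y) (f : Y → ι → ℂ) (e : Y → κ → ℂ)
    (he : ∀ y y', star (e y) ⬝ᵥ e y' = if y = y' then 1 else 0) :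
    (star fun p : ι × κ => ∑ y ∈ s, f y p.1 * e y p.2) ⬝ᵥ
        (fun p : ι × κ => ∑ y ∈ s, f y p.1 * e y p.2) =
      ∑ y ∈ s, star (f y) ⬝ᵥ f y := by
  have hinner (a : ι) : ∑ c, star (∑ y ∈ s, f y a * e y c) * ∑ y ∈ s, f y a * e y c =
      ∑ y ∈ s, star (f y a) * f y a := by
    calc _ = ∑ y ∈ s, ∑ y' ∈ s, star (f y a) * f y' a * (star (e y) ⬝ᵥ e y') := by
          simp only [star_sum, Finset.sum_mul_sum]
          simp only [dotProduct, Finset.mul_sum]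
          rw [Finset.sum_comm]
          refine Finset.sum_congr rfl fun y _ => ?_
          rw [Finset.sum_comm]
          refine Finset.sum_congr rfl fun y' _ => Finset.sum_congr rfl fun c _ => ?_
          simp only [star_mul', Pi.star_apply]
          ring
      _ = _ := by
          refine Finset.sum_congr rfl fun y hy => ?_
          simp [he, hy]
  rw [dotProduct, Fintype.sum_prod_type]
  simp only [Pi.star_apply, hinner, dotProduct]
  exact Finset.sum_comm

lemma star_dotProduct_self_eq_sum_normSq {ι : Type*} [Fintype ι] (v : ι → ℂ) :
    star v ⬝ᵥ v = ((∑ a, Complex.normSq (v a) : ℝ) : ℂ) := by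
  simp [dotProduct, Complex.normSq_eq_conj_mul_self]

lemma normSq_sum_mul_le {Y : Type*} (s : Finset Y) (f w : Y → ℂ) {r : ℝ}
    (hw : ∀ y ∈ s, Complex.normSq (w y) ≤ r) :
    Complex.normSq (∑ y ∈ s, f y * w y) ≤ s.card * (r * ∑ y ∈ s, Complex.normSq (f y)) := by
  rw [Complex.normSq_eq_norm_sq]
  calc ‖∑ y ∈ s, f y * w y‖ ^ 2 ≤ (∑ y ∈ s, ‖f y * w y‖) ^ 2 := by
        gcongr
        exact norm_sum_le _ _
    _ ≤ s.card * ∑ y ∈ s, ‖f y * w y‖ ^ 2 := sq_sum_le_card_mul_sum_sq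
    _ ≤ _ := by
        rw [Finset.mul_sum s _ r]
        gcongr with y hy
        rw [← Complex.normSq_eq_norm_sq, map_mul, mul_comm]
        exact mul_le_mul_of_nonneg_right (hw y hy) (Complex.normSq_nonneg _)

/-- If `|φ⟩ = Σ_{y ∈ B_δ(0^n)} α_y |ξ_y⟩_A |y⟩_θ̄` is a normalized state and `θ''` has
Hamming distance at least `d/2` from `θ̄`, then
`Tr((id_A ⊗ |0^n⟩⟨0^n|_{θ''}) |φ⟩⟨φ|) ≤ 2^{-d/2 + n h(δ)}`. -/
theorem stmt10 {n m d : ℕ} (δ : ℝ) (hδ0 : 0 ≤ δ) (hδ : δ ≤ 1 / 2)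
    (θbar θ'' : Fin n → Bool)
    (hdist : (d : ℝ) / 2 ≤ (hammingDist θ'' θbar : ℝ))
    (α : (Fin n → Bool) → ℂ) (ξ : (Fin n → Bool) → Fin m → ℂ)
    (hξ : ∀ y, star (ξ y) ⬝ᵥ ξ y = 1)
    (φ : Fin m × (Fin n → Bool) → ℂ)
    (hφ : φ = fun p => ∑ y ∈ hammingBall0 n δ, α y * ξ y p.1 * ketTheta θbar y p.2)
    (hnorm : star φ ⬝ᵥ φ = 1) :
    (star φ ⬝ᵥ
        (((1 : Matrix (Fin m) (Fin m) ℂ) ⊗ₖ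
            Matrix.vecMulVec (ketTheta θ'' (fun _ => false))
              (star (ketTheta θ'' (fun _ => false)))).mulVec φ)).re
      ≤ (2 : ℝ) ^ (-(d : ℝ) / 2 + n * binEnt δ) := by
  subst hφ
  set s := hammingBall0 n δ
  set u := ketTheta θ'' (fun _ => false)
  set f : (Fin n → Bool) → Fin m → ℂ := fun y a => α y * ξ y a
  have hsum : ∑ y ∈ s, ∑ a, Complex.normSq (f y a) = 1 := by
    have h := star_dotProduct_sum_orthonormal s f (ketTheta θbar) (ketTheta_orthonormal θbar)
    rw [hnorm] at h
    simp only [star_dotProduct_self_eq_sum_normSq] at h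
    exact_mod_cast h.symm
  have hoverlap (a : Fin m) : (star u ⬝ᵥ fun c => ∑ y ∈ s, f y a * ketTheta θbar y c) =
      ∑ y ∈ s, f y a * (star u ⬝ᵥ ketTheta θbar y) := by
    simp only [dotProduct, Finset.mul_sum]
    rw [Finset.sum_comm]
    exact Finset.sum_congr rfl fun y _ => Finset.sum_congr rfl fun c _ => mul_left_comm _ _ _
  have hw (y : Fin n → Bool) :
      Complex.normSq (star u ⬝ᵥ ketTheta θbar y) ≤ 2 ^ (-(d : ℝ) / 2) := by
    refine (normSq_ketTheta_overlap_le _ _ _ _).trans ?_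
    rw [inv_pow, ← Real.rpow_natCast, ← Real.rpow_neg zero_le_two]
    exact Real.rpow_le_rpow_of_exponent_le one_le_two (by linarith)
  rw [star_dotProduct_one_kronecker_vecMulVec, ← Complex.ofReal_sum, Complex.ofReal_re]
  calc ∑ a, Complex.normSq (star u ⬝ᵥ fun c => ∑ y ∈ s, f y a * ketTheta θbar y c)
      ≤ ∑ a, s.card * ((2 : ℝ) ^ (-(d : ℝ) / 2) * ∑ y ∈ s, Complex.normSq (f y a)) := by
        refine Finset.sum_le_sum fun a _ => ?_
        rw [hoverlap]
        exact normSq_sum_mul_le s (fun y => f y a) _ fun y _ => hw y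
    _ = s.card * (2 : ℝ) ^ (-(d : ℝ) / 2) := by
        rw [← Finset.mul_sum, ← Finset.mul_sum, Finset.sum_comm, hsum, mul_one]
    _ ≤ 2 ^ (n * binEnt δ) * 2 ^ (-(d : ℝ) / 2) := by
        gcongr
        exact card_hammingBall0_le n hδ0 hδ
    _ = _ := by rw [← Real.rpow_add zero_lt_two, add_comm]
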